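/- arXiv:1810.05803 — 3 statements merged into one kernel-verified Lean document; each statement's English description precedes it below -/
import Mathlib

section
/- Let p be a prime, let k be a finite field of characteristic p, let Γ be a group, and let V be a finite-dimensional k-vector space equipped with a k-linear action of Γ. Assume that, regarded as a module over 𝔽_p[Γ] (by restricting scalars to the prime field 𝔽_p), V is semisimple and multiplicity-free, i.e. V is a direct sum of simple 𝔽_p[Γ]-modules that are pairwise non-isomorphic. Then every simple k[Γ]-submodule U of V is also simple as an 𝔽_p[Γ]-module; moreover, the natural inclusion of End_{k[Γ]}(U) (k-linear Γ-equivariant endomorphisms) into End_{𝔽_p[Γ]}(U) (𝔽_p-linear Γ-equivariant endomorphisms) is a bijection, and this common endomorphism ring is a finite field containing the image of k under scalar multiplication. -/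
/-- The submodule, over the ring of additive endomorphisms generated by `Γ`, underlying a
`Γ`-stable additive subgroup. -/
def AddSubgroup.toClosureSubmodule {Γ V : Type*} [Group Γ] [AddCommGroup V]
    [DistribMulAction Γ V] (A : AddSubgroup V) (hA : ∀ (γ : Γ), ∀ v ∈ A, γ • v ∈ A) :
    Submodule (Subring.closure (Set.range (DistribMulAction.toAddMonoidEnd Γ V))) V where
  __ := A
  smul_mem' := by
    rintro ⟨r, hr⟩ v hv
    change r v ∈ A
    induction hr using Subring.closure_induction generalizing v with
    | mem x hx => obtain ⟨γ, rfl⟩ := hx; exact hA γ v hv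
    | zero => exact A.zero_mem
    | one => exact hv
    | add x y _ _ ihx ihy => exact A.add_mem (ihx hv) (ihy hv)
    | neg x _ ih => exact A.neg_mem (ih hv)
    | mul x y _ _ ihx ihy => exact ihx (ihy hv)

/-- A simple submodule of a multiplicity-free direct sum of simple modules is one of the
summands. -/
theorem Submodule.exists_eq_of_isSimpleModule_of_multiplicityFree {R M ι : Type*} [Ring R]
    [AddCommGroup M] [Module R M] [DecidableEq ι] (W : ι → Submodule R M)
    (hW : ∀ i, IsSimpleModule R (W i)) (hind : iSupIndep W) (htop : ⨆ i, W i = ⊤)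
    (hiso : ∀ i j, i ≠ j → IsEmpty (W i ≃ₗ[R] W j))
    (A : Submodule R M) [IsSimpleModule R A] : ∃ i, A = W i := by
  classical
  have hint := DirectSum.isInternal_submodule_of_iSupIndep_of_iSup_eq_top hind htop
  let e := LinearEquiv.ofBijective (DirectSum.coeLinearMap W) hint
  let π (i : ι) : A →ₗ[R] W i :=
    DirectSum.component R ι (fun i => W i) i ∘ₗ e.symm.toLinearMap ∘ₗ A.subtype
  have hπ (x : A) (i : ι) : π i x = e.symm x i := rfl
  have : Nontrivial A := IsSimpleModule.nontrivial R A
  obtain ⟨x, hx⟩ := exists_ne (0 : A)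
  obtain ⟨i, hi⟩ : ∃ i, π i x ≠ 0 := by
    by_contra! h
    refine hx (Subtype.ext (e.symm.injective ?_))
    ext i
    simpa [hπ] using h i
  have hbij : Function.Bijective (π i) :=
    (LinearMap.bijective_or_eq_zero (π i)).resolve_right fun h => hi (by simp [h])
  have hzero (j : ι) (hj : j ≠ i) : π j = 0 :=
    (LinearMap.bijective_or_eq_zero (π j)).resolve_left fun h =>
      (hiso i j hj.symm).false
        ((LinearEquiv.ofBijective _ hbij).symm.trans (LinearEquiv.ofBijective _ h))
  have hle : A ≤ W i := by
    intro y hy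
    have h : e.symm y = DirectSum.lof R ι (fun i => W i) i (π i ⟨y, hy⟩) := by
      refine DFinsupp.ext fun j => ?_
      by_cases hj : j = i
      · subst hj
        exact (DirectSum.lof_apply (M := fun i => W i) R j (π j ⟨y, hy⟩)).symm
      · rw [DirectSum.lof_eq_of, DirectSum.of_eq_of_ne _ _ _ hj]
        exact DFunLike.congr_fun (hzero j hj) ⟨y, hy⟩
    have h' := congrArg e h
    rw [e.apply_symm_apply] at h'
    rw [h']
    change DirectSum.coeLinearMap W _ ∈ _
    rw [DirectSum.coeLinearMap_lof]
    exact Subtype.property _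
  refine ⟨i, ((isSimpleModule_iff_isAtom.mp (hW i)).le_iff.mp hle).resolve_left ?_⟩
  exact (isSimpleModule_iff_isAtom.mp ‹_›).1

section DistribMulAction

variable {Γ V : Type*} [Group Γ] [AddCommGroup V] [DistribMulAction Γ V]

theorem AddSubgroup.isSimpleModule_toClosureSubmodule (A : AddSubgroup V)
    (hA : ∀ (γ : Γ), ∀ v ∈ A, γ • v ∈ A) (hne : A ≠ ⊥)
    (hsimple : ∀ A' : AddSubgroup V, A' ≤ A → (∀ (γ : Γ), ∀ v ∈ A', γ • v ∈ A') →
      A' = ⊥ ∨ A' = A) :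
    IsSimpleModule (Subring.closure (Set.range (DistribMulAction.toAddMonoidEnd Γ V)))
      (A.toClosureSubmodule hA) := by
  rw [isSimpleModule_iff_isAtom]
  refine ⟨fun h => hne (congrArg Submodule.toAddSubgroup h), fun B hB => ?_⟩
  have hstab : ∀ (γ : Γ), ∀ v ∈ B.toAddSubgroup, γ • v ∈ B.toAddSubgroup := fun γ v hv =>
    B.smul_mem ⟨DistribMulAction.toAddMonoidEnd Γ V γ, Subring.subset_closure ⟨γ, rfl⟩⟩ hv
  refine (hsimple B.toAddSubgroup hB.le hstab).elim
    (fun h => Submodule.toAddSubgroup_injective h) fun h => ?_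
  exact absurd (Submodule.toAddSubgroup_injective (a₂ := A.toClosureSubmodule hA) h) hB.ne

/-- A simple `Γ`-stable subgroup of a multiplicity-free direct sum of simple `Γ`-stable
subgroups is one of the summands. -/
theorem AddSubgroup.exists_eq_of_simple_of_multiplicityFree {ι : Type*} [DecidableEq ι]
    (W : ι → AddSubgroup V)
    (hstab : ∀ i (γ : Γ), ∀ v ∈ W i, γ • v ∈ W i) (hne : ∀ i, W i ≠ ⊥)
    (hsimple : ∀ i, ∀ W' : AddSubgroup V, W' ≤ W i →
      (∀ (γ : Γ), ∀ v ∈ W', γ • v ∈ W') → W' = ⊥ ∨ W' = W i)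
    (hind : iSupIndep W) (htop : ⨆ i, W i = ⊤)
    (hiso : ∀ i j, i ≠ j →
      ¬ ∃ e : (W i) ≃+ (W j), ∀ (γ : Γ) (x : W i) (hx : γ • (x : V) ∈ W i),
        ((e ⟨γ • (x : V), hx⟩ : W j) : V) = γ • ((e x : W j) : V))
    (A : AddSubgroup V) (hA : ∀ (γ : Γ), ∀ v ∈ A, γ • v ∈ A) (hAne : A ≠ ⊥)
    (hAsimple : ∀ A' : AddSubgroup V, A' ≤ A → (∀ (γ : Γ), ∀ v ∈ A', γ • v ∈ A') →
      A' = ⊥ ∨ A' = A) : ∃ i, A = W i := by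
  let N (i : ι) := (W i).toClosureSubmodule (hstab i)
  have := A.isSimpleModule_toClosureSubmodule hA hAne hAsimple
  have hNind : iSupIndep N := by
    rw [iSupIndep_iff_dfinsuppSumAddHom_injective] at hind
    exact (iSupIndep_iff_dfinsupp_lsum_injective N).mpr hind
  have hNtop : ⨆ i, N i = ⊤ := by
    refine Submodule.toAddSubgroup_injective (top_le_iff.mp ?_)
    rw [← htop]
    exact iSup_le fun i => (le_iSup N i : N i ≤ _)
  obtain ⟨i, hi⟩ := Submodule.exists_eq_of_isSimpleModule_of_multiplicityFree N
    (fun i => (W i).isSimpleModule_toClosureSubmodule (hstab i) (hne i) (hsimple i))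
    hNind hNtop
    (fun i j hij => ⟨fun e => hiso i j hij ⟨e.toAddEquiv, fun γ x _ =>
      congrArg Subtype.val (e.map_smul ⟨DistribMulAction.toAddMonoidEnd Γ V γ,
        Subring.subset_closure ⟨γ, rfl⟩⟩ x)⟩⟩)
    (A.toClosureSubmodule hA)
  exact ⟨i, congrArg Submodule.toAddSubgroup hi⟩

/-- Schur's lemma and Wedderburn's little theorem: the equivariant endomorphisms of a finite
simple `Γ`-module form a field. -/
theorem isField_centralizer_range_toAddMonoidEnd [Finite V] [Nontrivial V]
    (hsimple : ∀ A : AddSubgroup V, (∀ (γ : Γ), ∀ v ∈ A, γ • v ∈ A) → A = ⊥ ∨ A = ⊤) :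
    IsField (Subring.centralizer (Set.range (DistribMulAction.toAddMonoidEnd Γ V))) := by
  set D := Subring.centralizer (Set.range (DistribMulAction.toAddMonoidEnd Γ V))
  have hinj (f : D) (hf : f ≠ 0) : Function.Injective f.1 := by
    let φ : V →+ V := f.1
    have hcomm (γ : Γ) (v : V) : γ • φ v = φ (γ • v) :=
      DFunLike.congr_fun (Subring.mem_centralizer_iff.mp f.2 _ ⟨γ, rfl⟩) v
    rcases hsimple φ.ker (fun γ v hv => by
      rw [AddMonoidHom.mem_ker] at hv ⊢
      rw [← hcomm, hv, smul_zero]) with h | h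
    · exact (AddMonoidHom.ker_eq_bot_iff _).mp h
    · exact absurd (Subtype.ext (AddMonoidHom.ext fun v =>
        AddMonoidHom.mem_ker.mp (h ▸ AddSubgroup.mem_top v))) hf
  have : Finite (AddMonoid.End V) := Finite.of_injective _ DFunLike.coe_injective
  have : NoZeroDivisors D := ⟨fun {f g} h => by
    by_contra! hfg
    refine hfg.2 (Subtype.ext (AddMonoidHom.ext fun v => hinj f hfg.1 ?_))
    exact (DFunLike.congr_fun (congrArg Subtype.val h) v).trans (map_zero _).symm⟩
  have : Nontrivial D := by
    obtain ⟨v, hv⟩ := exists_ne (0 : V)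
    exact ⟨1, 0, fun h => hv (DFunLike.congr_fun (congrArg Subtype.val h) v)⟩
  have : IsDomain D := NoZeroDivisors.to_isDomain D
  exact Finite.isDomain_to_isField D

end DistribMulAction


/-- The multiplicity-free lemma (Lemma 5.2): let `k` be a finite field of characteristic
`p`, `Γ` a group, and `V` a finite-dimensional `k`-vector space with a `k`-linear
`Γ`-action which, as an `𝔽_p[Γ]`-module (equivalently, as an abelian group with
`Γ`-action, since additive subgroups are exactly `𝔽_p`-subspaces), is a direct sum of
pairwise non-isomorphic simple `𝔽_p[Γ]`-modules.  Then every simple `k[Γ]`-submodule `U`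
of `V` is simple as an `𝔽_p[Γ]`-module, every `Γ`-equivariant additive endomorphism of
`U` is `k`-linear (so the natural inclusion `End_{k[Γ]}(U) ⊆ End_{𝔽_p[Γ]}(U)` is a
bijection), and the ring of `Γ`-equivariant `k`-linear endomorphisms of `U` is a finite
field containing the image of `k` by scalar multiplication. -/
theorem multiplicity_free_lemma
    (p : ℕ) (hp : p.Prime)
    (k : Type) [Field k] [Fintype k] (hk : CharP k p)
    (Γ : Type) [Group Γ]
    (V : Type) [AddCommGroup V] [Module k V] [FiniteDimensional k V]
    [DistribMulAction Γ V] [SMulCommClass Γ k V]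
    -- `V` is semisimple and multiplicity-free as an `𝔽_p[Γ]`-module:
    (hss : ∃ (s : ℕ) (W : Fin s → AddSubgroup V),
      (∀ i (γ : Γ), ∀ v ∈ W i, γ • v ∈ W i) ∧
      (∀ i, W i ≠ ⊥) ∧
      (∀ i, ∀ W' : AddSubgroup V, W' ≤ W i →
        (∀ (γ : Γ), ∀ v ∈ W', γ • v ∈ W') → W' = ⊥ ∨ W' = W i) ∧
      iSupIndep W ∧ (⨆ i, W i) = ⊤ ∧
      (∀ i j, i ≠ j →
        ¬ ∃ e : (W i) ≃+ (W j), ∀ (γ : Γ) (x : W i) (hx : γ • (x : V) ∈ W i),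
            ((e ⟨γ • (x : V), hx⟩ : W j) : V) = γ • ((e x : W j) : V)))
    -- `U` is a simple `k[Γ]`-submodule of `V`:
    (U : Submodule k V)
    (hUstab : ∀ (γ : Γ), ∀ v ∈ U, γ • v ∈ U)
    (hUne : U ≠ ⊥)
    (hUsimple : ∀ U' : Submodule k V, U' ≤ U →
      (∀ (γ : Γ), ∀ v ∈ U', γ • v ∈ U') → U' = ⊥ ∨ U' = U) :
    -- (a) `U` is simple as an `𝔽_p[Γ]`-module:
    (∀ W' : AddSubgroup V, W' ≤ U.toAddSubgroup →
      (∀ (γ : Γ), ∀ v ∈ W', γ • v ∈ W') → W' = ⊥ ∨ W' = U.toAddSubgroup) ∧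
    -- (b) every `Γ`-equivariant additive endomorphism of `U` is `k`-linear:
    (∀ f : U →+ U,
      (∀ (γ : Γ) (x : U) (hx : γ • (x : V) ∈ U),
        ((f ⟨γ • (x : V), hx⟩ : U) : V) = γ • ((f x : U) : V)) →
      ∀ (c : k) (x : U), f (c • x) = c • f x) ∧
    -- (c) the ring of `Γ`-equivariant `k`-linear endomorphisms of `U` is a finite field
    --     containing the image of `k`:
    (let S : Set (Module.End k U) :=
      {f | ∀ (γ : Γ) (x : U) (hx : γ • (x : V) ∈ U),
        ((f ⟨γ • (x : V), hx⟩ : U) : V) = γ • ((f x : U) : V)}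
    S.Finite ∧
    (∀ c : k, algebraMap k (Module.End k U) c ∈ S) ∧
    (∀ f ∈ S, ∀ g ∈ S, f + g ∈ S ∧ f * g ∈ S) ∧
    (∀ f ∈ S, ∀ g ∈ S, f * g = g * f) ∧
    (∀ f ∈ S, f ≠ 0 → ∃ g ∈ S, f * g = 1 ∧ g * f = 1)) := by
  obtain ⟨s, W, hWstab, hWne, hWsimple, hind, htop, hiso⟩ := hss
  have : Finite V := Module.finite_of_finite k
  obtain ⟨A, hAU, ⟨hAstab, hAne⟩, hAmin⟩ : ∃ A ≤ U.toAddSubgroup,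
      ((∀ (γ : Γ), ∀ v ∈ A, γ • v ∈ A) ∧ A ≠ ⊥) ∧ ∀ B : AddSubgroup V,
        ((∀ (γ : Γ), ∀ v ∈ B, γ • v ∈ B) ∧ B ≠ ⊥) → B ≤ A → A ≤ B := by
    obtain ⟨A, hAU, hA⟩ := exists_minimal_le_of_wellFoundedLT
      (fun A : AddSubgroup V => (∀ (γ : Γ), ∀ v ∈ A, γ • v ∈ A) ∧ A ≠ ⊥) U.toAddSubgroup
      ⟨hUstab, fun h => hUne (Submodule.toAddSubgroup_injective h)⟩
    exact ⟨A, hAU, hA.prop, fun B hB hBA => hA.le_of_le hB hBA⟩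
  have hAsimple : ∀ A' : AddSubgroup V, A' ≤ A → (∀ (γ : Γ), ∀ v ∈ A', γ • v ∈ A') →
      A' = ⊥ ∨ A' = A := fun A' hle hst =>
    or_iff_not_imp_left.mpr fun hne => le_antisymm hle (hAmin A' ⟨hst, hne⟩ hle)
  have hmem := AddSubgroup.exists_eq_of_simple_of_multiplicityFree W hWstab hWne hWsimple hind
    htop hiso
  have hAsmul : ∀ c : k, ∀ v ∈ A, c • v ∈ A := by
    intro c v hv
    rcases eq_or_ne c 0 with rfl | hc
    · simp
    let m : V ≃+ V := DistribMulAction.toAddEquiv₀ V c hc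
    obtain ⟨i, hi⟩ := hmem A hAstab hAne hAsimple
    obtain ⟨j, hj⟩ := hmem (A.map m.toAddMonoidHom)
      (by
        rintro γ _ ⟨w, hw, rfl⟩
        exact ⟨γ • w, hAstab γ w hw, (smul_comm γ c w).symm⟩)
      (by
        exact fun h => hAne ((AddSubgroup.map_eq_bot_iff_of_injective A
          (f := m.toAddMonoidHom) m.injective).mp h))
      (by
        intro B hB hBstab
        have hB' : B = (B.map m.symm.toAddMonoidHom).map m.toAddMonoidHom := by
          rw [AddSubgroup.map_map]
          ext v
          simp
        rcases hAsimple (B.map m.symm.toAddMonoidHom)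
          (by
            rintro _ ⟨w, hw, rfl⟩
            obtain ⟨a, ha, rfl⟩ := hB hw
            simpa using ha)
          (by
            rintro γ _ ⟨w, hw, rfl⟩
            exact ⟨γ • w, hBstab γ w hw, (smul_comm γ c⁻¹ w).symm⟩) with h | h
        · left
          rw [hB', h, AddSubgroup.map_bot]
        · right
          rw [hB', h])
    have hij : i = j := by
      by_contra hij
      refine hiso i j hij ?_
      rw [← hi, ← hj]
      exact ⟨m.addSubgroupMap A, fun γ x _ => (smul_comm γ c (x : V)).symm⟩
    rw [hi, hij, ← hj]
    exact ⟨v, hv, rfl⟩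
  have hAeq : A = U.toAddSubgroup := by
    let A' : Submodule k V := { A with smul_mem' := hAsmul }
    rcases hUsimple A' hAU hAstab with h | h
    · exact absurd (congrArg Submodule.toAddSubgroup h) hAne
    · exact congrArg Submodule.toAddSubgroup h
  subst hAeq
  refine ⟨hAsimple, ?_⟩
  let act : DistribMulAction Γ U :=
    { smul := fun γ x => ⟨γ • (x : V), hUstab γ x x.2⟩
      one_smul := fun x => Subtype.ext (one_smul Γ (x : V))
      mul_smul := fun γ δ x => Subtype.ext (mul_smul γ δ (x : V))
      smul_zero := fun γ => Subtype.ext (smul_zero γ)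
      smul_add := fun γ x y => Subtype.ext (smul_add γ (x : V) (y : V)) }
  have : Nontrivial U := Submodule.nontrivial_iff_ne_bot.mpr hUne
  have hfield := isField_centralizer_range_toAddMonoidEnd (Γ := Γ) (V := U) (by
    intro B hB
    rcases hAsimple (B.map U.toAddSubgroup.subtype)
      (by rintro _ ⟨x, -, rfl⟩; exact x.2)
      (by rintro γ _ ⟨x, hx, rfl⟩; exact ⟨γ • x, hB γ x hx, rfl⟩) with h | h
    · exact Or.inl ((AddSubgroup.map_eq_bot_iff_of_injective _
        U.toAddSubgroup.subtype_injective).mp h)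
    · refine Or.inr (top_le_iff.mp fun x _ => ?_)
      obtain ⟨y, hy, hyx⟩ := h.ge x.2
      exact Subtype.ext hyx ▸ hy)
  set D := Subring.centralizer (Set.range (DistribMulAction.toAddMonoidEnd Γ U)) with hD
  have hmemD (f : U →+ U) : f ∈ D ↔ ∀ (γ : Γ) (x : U) (hx : γ • (x : V) ∈ U),
      ((f ⟨γ • (x : V), hx⟩ : U) : V) = γ • ((f x : U) : V) := by
    refine (Subring.mem_centralizer_iff (R := AddMonoid.End U)).trans (Set.forall_mem_range.trans ?_)
    refine forall_congr' fun γ => ⟨fun h x _ => ?_, fun h => AddMonoidHom.ext fun x => ?_⟩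
    · exact congrArg Subtype.val (DFunLike.congr_fun h x).symm
    · exact Subtype.ext (h x (hUstab γ x x.2)).symm
  have hcommD (f g : U →+ U) (hf : f ∈ D) (hg : g ∈ D) (x : U) : f (g x) = g (f x) :=
    DFunLike.congr_fun (congrArg Subtype.val (hfield.mul_comm ⟨f, hf⟩ ⟨g, hg⟩)) x
  have hscalar (c : k) : (algebraMap k (Module.End k U) c).toAddMonoidHom ∈ D :=
    (hmemD _).mpr fun γ x _ => (smul_comm γ c (x : V)).symm
  have hlin (f : U →+ U) (hf : f ∈ D) (c : k) (x : U) : f (c • x) = c • f x :=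
    hcommD f _ hf (hscalar c) x
  refine ⟨fun f hf => hlin f ((hmemD f).mpr hf), ?_⟩
  intro S
  have hS (f : Module.End k U) : f ∈ S ↔ f.toAddMonoidHom ∈ D := (hmemD f.toAddMonoidHom).symm
  have : Finite (Module.End k U) := Finite.of_injective _ DFunLike.coe_injective
  refine ⟨S.toFinite, fun c => (hS _).mpr (hscalar c), fun f hf g hg => ?_,
    fun f hf g hg => LinearMap.ext (hcommD _ _ ((hS f).mp hf) ((hS g).mp hg)),
    fun f hf hne => ?_⟩
  · rw [hS] at hf hg ⊢
    exact ⟨D.add_mem hf hg, (hS _).mpr (D.mul_mem hf hg)⟩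
  · rw [hS] at hf
    obtain ⟨⟨g, hg⟩, hfg⟩ := hfield.mul_inv_cancel (a := ⟨f.toAddMonoidHom, hf⟩) fun h =>
      hne (LinearMap.ext fun x => DFunLike.congr_fun (congrArg Subtype.val h) x)
    have hfg' (x : U) : f (g x) = x := DFunLike.congr_fun (congrArg Subtype.val hfg) x
    let g' : Module.End k U := { g with map_smul' := hlin g hg }
    exact ⟨g', (hS g').mpr hg, LinearMap.ext hfg',
      LinearMap.ext fun x => (hcommD _ _ hg hf x).trans (hfg' x)⟩
end

section
/- Let p be a prime, let G be a group, let N be a normal subgroup of G, and let W be a finite simple 𝔽_p[G]-module on which N acts trivially. Let k_W := End_{𝔽_p[G]}(W) be the ring of 𝔽_p-linear Γ-equivariant endomorphisms of W (a finite field, by Schur's lemma and Wedderburn's theorem). Assume H¹(G/N, W) = 0 for the induced action of G/N on W. Let ψ_1, …, ψ_s : G → W be 1-cocycles (ψ(gh) = ψ(g) + g·ψ(h) for all g, h ∈ G) whose cohomology classes in H¹(G, W) are linearly independent over k_W, meaning: for every tuple (a_1, …, a_s) ∈ k_W^s not all zero, the cocycle a_1∘ψ_1 + ⋯ + a_s∘ψ_s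 is not a coboundary. Then each restriction ψ_i|_N : N → W is a group homomorphism, and the map N → W^{⊕s} given by n ↦ (ψ_1(n), …, ψ_s(n)) is a surjective group homomorphism. -/
/-- A proper `G`-stable subgroup of a finite power of a simple `G`-module `W` is annihilated by a
nonzero tuple of `G`-equivariant endomorphisms of `W`. -/
theorem exists_equivariant_relation_of_ne_top {G W : Type*} [Monoid G] [AddCommGroup W]
    [DistribMulAction G W] (hW_nontriv : ∃ w : W, w ≠ 0)
    (hW_simple : ∀ U : AddSubgroup W, (∀ (g : G), ∀ w ∈ U, g • w ∈ U) → U = ⊥ ∨ U = ⊤) :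
    ∀ (s : ℕ) (M : AddSubgroup (Fin s → W)), (∀ (g : G), ∀ m ∈ M, g • m ∈ M) → M ≠ ⊤ →
      ∃ a : Fin s → (W →+ W), (∀ i (g : G) (w : W), a i (g • w) = g • a i w) ∧
        (∃ i, a i ≠ 0) ∧ ∀ m ∈ M, ∑ i, a i (m i) = 0 := by
  intro s
  induction s with
  | zero => exact fun M _ hM => (hM (Subsingleton.elim _ _)).elim
  | succ s ih =>
    intro M hMG hM
    let tail : (Fin (s + 1) → W) →+ (Fin s → W) :=
      { toFun := Fin.tail, map_zero' := rfl, map_add' := fun _ _ => rfl }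
    by_cases hP : M.map tail = ⊤
    · -- `M` is the graph of an equivariant map `(Fin s → W) → W`
      let K : AddSubgroup W := M.comap (AddMonoidHom.single (fun _ : Fin (s + 1) => W) 0)
      have hKG : ∀ (g : G), ∀ w ∈ K, g • w ∈ K := fun g w hw => by
        have := hMG g _ hw
        simpa [K, AddSubgroup.mem_comap, Pi.single_smul] using this
      have hex : ∀ v : Fin s → W, ∃ x : W, Fin.cons x v ∈ M := fun v => by
        have hv : v ∈ M.map tail := hP ▸ AddSubgroup.mem_top v
        obtain ⟨m, hm, rfl⟩ := hv
        exact ⟨m 0, (Fin.cons_self_tail m).symm ▸ hm⟩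
      have hcons : ∀ (x y : W) (v : Fin s → W),
          (Fin.cons x v : Fin (s + 1) → W) - Fin.cons y v = Pi.single 0 (x - y) := by
        intro x y v
        ext j
        refine Fin.cases ?_ (fun j => ?_) j <;> simp
      rcases hW_simple K hKG with hK | hK
      · have huniq : ∀ (v : Fin s → W) (x y : W),
            Fin.cons x v ∈ M → Fin.cons y v ∈ M → x = y := fun v x y hx hy => by
          have hxy : x - y ∈ K := by
            have := M.sub_mem hx hy
            rwa [hcons] at this
          rw [hK] at hxy
          exact sub_eq_zero.mp hxy
        choose h hh using hex
        have hadd : ∀ u v, h (u + v) = h u + h v := fun u v => by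
          refine huniq (u + v) _ _ (hh _) ?_
          convert M.add_mem (hh u) (hh v) using 1
          ext j
          refine Fin.cases ?_ (fun j => ?_) j <;> simp
        have hsmul : ∀ (g : G) v, h (g • v) = g • h v := fun g v => by
          refine huniq (g • v) _ _ (hh _) ?_
          convert hMG g _ (hh v) using 1
          ext j
          refine Fin.cases ?_ (fun j => ?_) j <;> simp
        let H : (Fin s → W) →+ W := AddMonoidHom.mk' h hadd
        refine ⟨Fin.cons (AddMonoidHom.id W)
          fun i => -(H.comp (AddMonoidHom.single (fun _ => W) i)), ?_, ⟨0, ?_⟩, ?_⟩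
        · intro i g w
          refine Fin.cases ?_ (fun j => ?_) i
          · simp
          · simp [H, Pi.single_smul, hsmul]
        · obtain ⟨w, hw⟩ := hW_nontriv
          exact fun h0 => hw (DFunLike.congr_fun h0 w)
        · intro m hm
          have h0 : m 0 = H (Fin.tail m) :=
            huniq (Fin.tail m) _ _ (by simpa using hm) (hh _)
          have hsum : ∑ i, H (Pi.single i (m (Fin.succ i))) = H (Fin.tail m) := by
            rw [← map_sum]
            exact congrArg H (Finset.univ_sum_single (Fin.tail m))
          simp [Fin.sum_univ_succ, hsum, h0]
      · refine (hM ((AddSubgroup.eq_top_iff' M).mpr fun m => ?_)).elim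
        obtain ⟨x, hx⟩ := hex (Fin.tail m)
        have hK' : m 0 - x ∈ K := hK ▸ AddSubgroup.mem_top _
        have hsub : m - Fin.cons x (Fin.tail m) ∈ M := by
          have := hcons (m 0) x (Fin.tail m)
          rw [Fin.cons_self_tail] at this
          rw [this]
          exact hK'
        simpa using M.add_mem hsub hx
    · obtain ⟨a, haG, ⟨i, hi⟩, ha⟩ := ih (M.map tail) (by
        rintro g _ ⟨m, hm, rfl⟩
        exact ⟨g • m, hMG g m hm, rfl⟩) hP
      refine ⟨Fin.cons 0 a, fun j g w => ?_, ⟨i.succ, by simpa using hi⟩, fun m hm => ?_⟩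
      · refine Fin.cases ?_ (fun j => ?_) j
        · simp
        · simpa using haG j g w
      · rw [Fin.sum_univ_succ]
        simpa [Fin.tail] using ha (Fin.tail m) ⟨m, hm, rfl⟩


/-- The group-cohomological content of Lemma 4.4: let `W` be a finite simple
`𝔽_p[G]`-module on which a normal subgroup `N ⊴ G` acts trivially, with
`H¹(G/N, W) = 0` (phrased as: every cocycle `G → W` vanishing on `N` is a coboundary).
If `ψ_1, …, ψ_s : G → W` are cocycles whose classes are linearly independent over
`k_W = End_{𝔽_p[G]}(W)` (phrased as: no nonzero `k_W`-combination of them is a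
coboundary), then each `ψ_i` restricts to a homomorphism on `N` and
`n ↦ (ψ_1(n), …, ψ_s(n))` maps `N` onto `W^{⊕s}`. -/
theorem cocycles_surject_on_normal_subgroup
    (p : ℕ) (hp : p.Prime)
    (G : Type) [Group G] (N : Subgroup G) (hN : N.Normal)
    (W : Type) [AddCommGroup W] [Finite W] [DistribMulAction G W]
    (htor : ∀ w : W, p • w = 0)
    (hW_nontriv : ∃ w : W, w ≠ 0)
    (hW_simple : ∀ U : AddSubgroup W,
      (∀ (g : G), ∀ w ∈ U, g • w ∈ U) → U = ⊥ ∨ U = ⊤)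
    (hNtriv : ∀ n ∈ N, ∀ w : W, n • w = w)
    (hH1 : ∀ φ : G → W, (∀ g h, φ (g * h) = φ g + g • φ h) →
      (∀ n ∈ N, φ n = 0) → ∃ w : W, ∀ g, φ g = g • w - w)
    (s : ℕ) (ψ : Fin s → G → W)
    (hcocycle : ∀ i (g h : G), ψ i (g * h) = ψ i g + g • ψ i h)
    (hindep : ∀ a : Fin s → (W →+ W),
      (∀ i (g : G) (w : W), a i (g • w) = g • a i w) →
      (∃ i, a i ≠ 0) →
      ¬ ∃ w : W, ∀ g, (∑ i, a i (ψ i g)) = g • w - w) :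
    (∀ i, ∀ n ∈ N, ∀ m ∈ N, ψ i (n * m) = ψ i n + ψ i m) ∧
    (∀ w : Fin s → W, ∃ n ∈ N, ∀ i, ψ i n = w i) := by
  have hadd : ∀ i, ∀ n ∈ N, ∀ m, ψ i (n * m) = ψ i n + ψ i m := fun i n hn m => by
    rw [hcocycle, hNtriv n hn]
  refine ⟨fun i n hn m _ => hadd i n hn m, ?_⟩
  have hconj : ∀ i g, ∀ n ∈ N, ψ i (g * n * g⁻¹) = g • ψ i n := fun i g n hn => by
    have h1 := hadd i (g * n * g⁻¹) (hN.conj_mem n hn g) g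
    rw [inv_mul_cancel_right, hcocycle, add_comm] at h1
    exact (add_right_cancel h1).symm
  let Ψ : N →* Multiplicative (Fin s → W) := MonoidHom.mk'
    (fun n => Multiplicative.ofAdd fun i => ψ i n)
    (fun n m => congrArg Multiplicative.ofAdd (funext fun i => hadd i n n.2 m))
  let M : AddSubgroup (Fin s → W) := (MonoidHom.toAdditiveLeft Ψ).range
  have hM_mem : ∀ w, w ∈ M ↔ ∃ n ∈ N, ∀ i, ψ i n = w i := fun w =>
    ⟨fun ⟨n, hn⟩ => ⟨n.toMul.1, n.toMul.2, congrFun hn⟩,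
      fun ⟨n, hn, h⟩ => ⟨Additive.ofMul ⟨n, hn⟩, funext h⟩⟩
  suffices hM : M = ⊤ from fun w => (hM_mem w).mp (hM ▸ AddSubgroup.mem_top w)
  by_contra hM
  obtain ⟨a, haG, ha0, ha⟩ := exists_equivariant_relation_of_ne_top hW_nontriv hW_simple s M
    (fun g m hm => by
      obtain ⟨n, hn, h⟩ := (hM_mem m).mp hm
      exact (hM_mem _).mpr ⟨g * n * g⁻¹, hN.conj_mem n hn g, fun i => by
        rw [hconj i g n hn, h, Pi.smul_apply]⟩) hM
  refine hindep a haG ha0 (hH1 _ (fun g h => ?_) fun n hn => ?_)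
  · simp only [hcocycle, map_add, haG, Finset.sum_add_distrib, Finset.smul_sum]
  · exact ha _ ((hM_mem _).mpr ⟨n, hn, fun _ => rfl⟩)
end

section
/- Let p be a prime and let G be a finite group admitting a chain of normal subgroups G = G_0 ⊇ G_1 ⊇ ⋯ ⊇ G_m = {1} (each G_i normal in G) such that: (i) the index [G : G_1] is coprime to p; and (ii) for each 1 ≤ i < m, the quotient G_i/G_{i+1} is an elementary abelian p-group, the conjugation action of G on G_i/G_{i+1} factors through the quotient G/G_1, and the induced action of G/G_1 on G_i/G_{i+1} has no nonzero fixed points. Then there is no surjective group homomorphism from G onto ℤ/pℤ; in particular G has no normal subgroup of index p. -/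
/-- If a group `G` acts on a commutative group `A` without nontrivial fixed points, with `H` acting
trivially, then the values of any `G`-invariant homomorphism on `A` are killed by the index of
`H`. -/
theorem pow_index_eq_one_of_invariant {G A C : Type*} [Group G] [CommGroup A] [CommGroup C]
    (ρ : G →* MulAut A) (H : Subgroup G) [H.FiniteIndex]
    (htriv : ∀ h ∈ H, ρ h = 1) (hfix : ∀ a, (∀ g, ρ g a = a) → a = 1)
    (f : A →* C) (hf : ∀ g a, f (ρ g a) = f a) (a : A) : f a ^ H.index = 1 := by
  classical
  have : Fintype (G ⧸ H) := H.fintypeQuotientOfFiniteIndex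
  let orbit : G ⧸ H → A := Quotient.lift (fun g => ρ g a) fun x y hxy => by
    have h := htriv _ (QuotientGroup.leftRel_apply.mp hxy)
    rw [map_mul, map_inv, inv_mul_eq_one] at h
    simp only [h]
  have hnorm : ∏ q, orbit q = 1 := by
    refine hfix _ fun g => ?_
    rw [map_prod]
    refine Fintype.prod_equiv (MulAction.toPerm g) _ _ fun q => ?_
    induction q using QuotientGroup.induction_on with
    | H x => exact (congrArg (fun e : MulAut A => e a) (map_mul ρ g x)).symm
  have hval : ∀ q, f (orbit q) = f a := fun q => by
    induction q using QuotientGroup.induction_on with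
    | H x => exact hf x a
  have h := congrArg f hnorm
  rw [map_prod, map_one] at h
  simpa [hval, Subgroup.index, Nat.card_eq_fintype_card] using h

/-- Let `N ≤ K` be normal subgroups of `G` with `K / N` commutative, on which conjugation by `H` is
trivial and conjugation by `G` has no nontrivial fixed points. A homomorphism from `G` to a
commutative group that is trivial on `N` has its values on `K` killed by the index of `H`. -/
theorem pow_index_eq_one_of_conj {G C : Type*} [Group G] [CommGroup C]
    (H K N : Subgroup G) [H.FiniteIndex] [K.Normal] [N.Normal]
    (hab : ∀ x ∈ K, ∀ y ∈ K, x * y * x⁻¹ * y⁻¹ ∈ N)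
    (hfactor : ∀ g ∈ H, ∀ x ∈ K, g * x * g⁻¹ * x⁻¹ ∈ N)
    (hnofix : ∀ x ∈ K, (∀ g : G, g * x * g⁻¹ * x⁻¹ ∈ N) → x ∈ N)
    (f : G →* C) (hf : N ≤ f.ker) {x : G} (hx : x ∈ K) : f x ^ H.index = 1 := by
  let π := QuotientGroup.mk' N
  have hπ : ∀ a b : G, a * b⁻¹ ∈ N ↔ π a = π b := fun a b => by
    rw [← mul_inv_eq_one, ← map_inv, ← map_mul]
    exact (QuotientGroup.eq_one_iff _).symm
  let A := K.map π
  have : A.Normal := Subgroup.Normal.map inferInstance π (QuotientGroup.mk'_surjective N)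
  let _ : CommGroup A :=
    { (inferInstance : Group A) with
      mul_comm := by
        rintro ⟨_, a, ha, rfl⟩ ⟨_, b, hb, rfl⟩
        have h := (hπ _ _).mp (hab a ha b hb)
        rw [map_mul, map_mul, map_inv, mul_inv_eq_iff_eq_mul] at h
        exact Subtype.ext h }
  let ρ : G →* MulAut A := MulAut.conjNormal.comp π
  have hρ : ∀ g (a : A), (ρ g a : G ⧸ N) = π g * a * (π g)⁻¹ := fun g a =>
    MulAut.conjNormal_apply _ _
  let F : A →* C := (QuotientGroup.lift N f hf).comp A.subtype
  refine pow_index_eq_one_of_invariant ρ H ?_ ?_ F ?_ ⟨π x, x, hx, rfl⟩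
  · intro h hh
    ext ⟨_, a, ha, rfl⟩
    rw [hρ]
    simpa using (hπ _ _).mp (hfactor h hh a ha)
  · rintro ⟨_, a, ha, rfl⟩ h
    refine Subtype.ext ((QuotientGroup.eq_one_iff a).mpr (hnofix a ha fun g => ?_))
    have hg := congrArg Subtype.val (h g)
    rw [hρ] at hg
    rw [hπ]
    simpa using hg
  · intro g a
    change QuotientGroup.lift N f hf (ρ g a) = QuotientGroup.lift N f hf a
    rw [hρ, map_mul, map_mul, map_inv, mul_inv_cancel_comm]


/-- Lemma 3.8: a finite group `G` admitting a chain of normal subgroups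
`G = G_0 ⊇ G_1 ⊇ ⋯ ⊇ G_m = 1` with `[G : G_1]` coprime to `p`, such that for
`1 ≤ i < m` each quotient `G_i/G_{i+1}` is elementary abelian of exponent `p`, the
conjugation action of `G` on it factors through `G/G_1`, and this action has no nonzero
fixed points, admits no surjection onto `ℤ/pℤ`; in particular `G` has no normal subgroup
of index `p`. -/
theorem no_index_p_quotient
    (p : ℕ) (hp : p.Prime)
    (G : Type) [Group G] [Finite G]
    (m : ℕ) (hm : 1 ≤ m) (Gs : ℕ → Subgroup G)
    (h0 : Gs 0 = ⊤) (hlast : Gs m = ⊥)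
    (hchain : ∀ i < m, Gs (i + 1) ≤ Gs i)
    (hnormal : ∀ i ≤ m, (Gs i).Normal)
    (hindex : Nat.Coprime (Gs 1).index p)
    (hpow : ∀ i, 1 ≤ i → i < m → ∀ x ∈ Gs i, x ^ p ∈ Gs (i + 1))
    (hab : ∀ i, 1 ≤ i → i < m →
      ∀ x ∈ Gs i, ∀ y ∈ Gs i, x * y * x⁻¹ * y⁻¹ ∈ Gs (i + 1))
    (hfactor : ∀ i, 1 ≤ i → i < m →
      ∀ g ∈ Gs 1, ∀ x ∈ Gs i, g * x * g⁻¹ * x⁻¹ ∈ Gs (i + 1))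
    (hnofix : ∀ i, 1 ≤ i → i < m →
      ∀ x ∈ Gs i, (∀ g : G, g * x * g⁻¹ * x⁻¹ ∈ Gs (i + 1)) → x ∈ Gs (i + 1)) :
    (¬ ∃ f : G →* Multiplicative (ZMod p), Function.Surjective f) ∧
    (¬ ∃ H : Subgroup G, H.Normal ∧ H.index = p) := by
  have key : ∀ f : G →* Multiplicative (ZMod p), ∀ g, f g = 1 := by
    intro f
    have hone : ∀ c : Multiplicative (ZMod p), c ^ (Gs 1).index = 1 → c = 1 := fun c hc => by
      have hcp : c ^ p = 1 := by
        have h := pow_card_eq_one' (x := c)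
        rwa [Nat.card_congr Multiplicative.toAdd, Nat.card_zmod] at h
      have h := pow_gcd_eq_one.mpr ⟨hc, hcp⟩
      rwa [hindex.gcd_eq_one, pow_one] at h
    have hker : Gs 1 ≤ f.ker := by
      refine Nat.decreasingInduction' (P := fun i => Gs i ≤ f.ker) ?_ hm ?_
      · intro i him hi hN x hx
        have := hnormal i him.le
        have := hnormal (i + 1) him
        exact hone _ (pow_index_eq_one_of_conj (Gs 1) (Gs i) (Gs (i + 1)) (hab i hi him)
          (hfactor i hi him) (hnofix i hi him) f hN hx)
      · rw [hlast]
        exact bot_le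
    intro g
    have := hnormal 1 hm
    refine hone _ ?_
    rw [← map_pow]
    exact hker ((Gs 1).pow_index_mem g)
  have hsurj : ¬ ∃ f : G →* Multiplicative (ZMod p), Function.Surjective f := by
    rintro ⟨f, hf⟩
    have : Fact p.Prime := ⟨hp⟩
    obtain ⟨c, hc⟩ := exists_ne (1 : Multiplicative (ZMod p))
    obtain ⟨g, rfl⟩ := hf c
    exact hc (key f g)
  refine ⟨hsurj, ?_⟩
  rintro ⟨H, hH, hHp⟩
  have : Fact p.Prime := ⟨hp⟩
  let e : G ⧸ H ≃* Multiplicative (ZMod p) := mulEquivOfPrimeCardEq (p := p) hHp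
    ((Nat.card_congr Multiplicative.toAdd).trans (Nat.card_zmod p))
  exact hsurj ⟨e.toMonoidHom.comp (QuotientGroup.mk' H),
    e.surjective.comp (QuotientGroup.mk'_surjective H)⟩
end
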